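/- arXiv:2303.12005 — 2 statements merged into one kernel-verified Lean document; each statement's English description precedes it below -/
import Mathlib

section
/- One has C̄ ∩ B ⊆ Π: every real vector x = (d; m_1, …, m_8) ∈ V satisfying (x, α_i) ≥ 0 for all i = 0, …, 7 and 0 ≤ m_i ≤ d for all i ∈ {1, …, 8} lies in the cone Π. -/
noncomputable section

abbrev V : Type := Fin 9 → ℝ

/-- The hyperplane class `H`. -/
def Hv : V := fun j => if j = 0 then 1 else 0

/-- The exceptional classes `E_1, …, E_8` (indexed by `Fin 8`). -/
def Ev (i : Fin 8) : V := fun j => if j = i.succ then 1 else 0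

/-- The class `(d; m_1, …, m_8) = d·H − ∑ m_i·E_i`. -/
def cls (d : ℝ) (m : Fin 8 → ℝ) : V := d • Hv - ∑ i : Fin 8, m i • Ev i

/-- The symmetric bilinear form with `(H,H) = 2`, `(E_i,E_j) = −δ_{ij}`, `(H,E_i) = 0`. -/
def form (x y : V) : ℝ := 2 * x 0 * y 0 - ∑ i : Fin 8, x i.succ * y i.succ

/-- The canonical class `K = −4H + 2∑ E_i`. -/
def Kv : V := (-4 : ℝ) • Hv + (2 : ℝ) • ∑ i : Fin 8, Ev i

/-- The simple roots `α_0, …, α_7`:  `α_0 = H − E_1 − E_2 − E_3 − E_4` and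
`α_i = E_i − E_{i+1}` for `i = 1, …, 7`. -/
def α (i : Fin 8) : V :=
  if i = 0 then Hv - Ev 0 - Ev 1 - Ev 2 - Ev 3 else Ev (i - 1) - Ev i

lemma form_add_right (a x y : V) : form a (x + y) = form a x + form a y := by
  simp only [form, Pi.add_apply, mul_add, Finset.sum_add_distrib]; ring

lemma form_smul_right (a : V) (c : ℝ) (x : V) : form a (c • x) = c * form a x := by
  unfold form
  simp only [Pi.smul_apply, smul_eq_mul]
  rw [show ∑ i : Fin 8, a i.succ * (c * x i.succ)
      = c * ∑ i : Fin 8, a i.succ * x i.succ from by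
    rw [Finset.mul_sum]; exact Finset.sum_congr rfl fun i _ => by ring]
  ring

/-- The reflection `x ↦ x + (a, x)·a` as a linear map. -/
def reflLin (a : V) : V →ₗ[ℝ] V where
  toFun x := x + form a x • a
  map_add' x y := by simp only [form_add_right, add_smul]; abel
  map_smul' c x := by
    simp only [form_smul_right, RingHom.id_apply, smul_add, smul_smul]

lemma form_alpha_self (i : Fin 8) : form (α i) (α i) = -2 := by
  fin_cases i <;>
    simp +decide [form, α, Hv, Ev, Fin.sum_univ_eight] <;> norm_num

lemma refl_refl (a : V) (h : form a a = -2) (x : V) :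
    reflLin a (reflLin a x) = x := by
  show (x + form a x • a) + form a (x + form a x • a) • a = x
  rw [form_add_right, form_smul_right, h]
  module

/-- The simple reflections `s_0, …, s_7` as linear automorphisms of `V`. -/
def sEquiv (i : Fin 8) : V ≃ₗ[ℝ] V :=
  LinearEquiv.ofLinear (reflLin (α i)) (reflLin (α i))
    (LinearMap.ext fun x => refl_refl _ (form_alpha_self i) x)
    (LinearMap.ext fun x => refl_refl _ (form_alpha_self i) x)

/-- The Weyl group `W`, the subgroup of `GL(V)` generated by `s_0, …, s_7`. -/
def W : Subgroup (V ≃ₗ[ℝ] V) := Subgroup.closure (Set.range sEquiv)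

/-- Membership in the convex cone generated by a set `S ⊆ V`. -/
def inCone (S : Set V) (x : V) : Prop :=
  ∃ (n : ℕ) (c : Fin n → ℝ) (g : Fin n → V),
    (∀ i, 0 ≤ c i) ∧ (∀ i, g i ∈ S) ∧ x = ∑ i, c i • g i

/-- The generators of the cone `Π` from Lemma `lem:standardinPi`. -/
def PiGens : Set V :=
  {Hv}
  ∪ {x | ∃ i : Fin 8, i.1 < 3 ∧ x = Hv - Ev i}
  ∪ {x | ∃ i j : Fin 8, i < j ∧ j.1 < 3 ∧ x = Hv - Ev i - Ev j}
  ∪ {x | ∃ k : ℕ, 4 ≤ k ∧ k ≤ 8 ∧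
      x = (2 : ℝ) • Hv - ∑ i ∈ Finset.univ.filter (fun i : Fin 8 => i.1 < k), Ev i}
  ∪ {x | ∃ l : ℕ, 4 ≤ l ∧ l ≤ 8 ∧
      x = (3 : ℝ) • Hv - (3 : ℝ) • Ev 0
          - ∑ i ∈ Finset.univ.filter (fun i : Fin 8 => 1 ≤ i.1 ∧ i.1 < l), Ev i}

/-- The cone `Π`, i.e. the convex cone generated by `PiGens`. -/
def PiCone : Set V := {x | inCone PiGens x}

/-- The closed fundamental chamber `C̄ = {x | (x, α_i) ≥ 0 for all i}`. -/
def Cbar : Set V := {x | ∀ i : Fin 8, 0 ≤ form x (α i)}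

/-- The set `B = {(d; m_1, …, m_8) | 0 ≤ m_i ≤ d for all i}`; here the `i`-th
multiplicity of `x` is `-x i.succ` and the degree is `x 0`. -/
def Bset : Set V := {x | ∀ i : Fin 8, 0 ≤ -x i.succ ∧ -x i.succ ≤ x 0}

/-- The orbit `W·E_8` of the exceptional class `E_8` under the Weyl group. -/
def orbitE8 : Set V := {x | ∃ w : V ≃ₗ[ℝ] V, w ∈ W ∧ x = w (Ev 7)}

lemma inCone_smul {S : Set V} {x : V} (hx : x ∈ S) {c : ℝ} (hc : 0 ≤ c) : inCone S (c • x) :=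
  ⟨1, fun _ => c, fun _ => x, fun _ => hc, fun _ => hx, by simp⟩

lemma inCone_add {S : Set V} {x y : V} (hx : inCone S x) (hy : inCone S y) :
    inCone S (x + y) := by
  obtain ⟨n, c, g, hc, hg, rfl⟩ := hx
  obtain ⟨n', c', g', hc', hg', rfl⟩ := hy
  refine ⟨n + n', Fin.append c c', Fin.append g g', ?_, ?_, by simp [Fin.sum_univ_add]⟩
  · intro i
    induction i using Fin.addCases <;> simp [hc, hc']
  · intro i
    induction i using Fin.addCases <;> simp [hg, hg']

/-- The class `L_k = 2H − ∑_{i ≤ k} E_i`. -/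
def Lv (k : ℕ) : V :=
  (2 : ℝ) • Hv - ∑ i ∈ Finset.univ.filter (fun i : Fin 8 => i.1 < k), Ev i

/-- The class `M_l = 3H − 3E_1 − ∑_{2 ≤ i ≤ l} E_i`. -/
def Mv (l : ℕ) : V :=
  (3 : ℝ) • Hv - (3 : ℝ) • Ev 0
    - ∑ i ∈ Finset.univ.filter (fun i : Fin 8 => 1 ≤ i.1 ∧ i.1 < l), Ev i

lemma Hv_mem_PiGens : Hv ∈ PiGens := by simp [PiGens]

lemma Hv_sub_mem_PiGens {i : Fin 8} (hi : i.1 < 3) : Hv - Ev i ∈ PiGens :=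
  Or.inl (Or.inl (Or.inl (Or.inr ⟨i, hi, rfl⟩)))

lemma Hv_sub_sub_mem_PiGens {i j : Fin 8} (hij : i < j) (hj : j.1 < 3) :
    Hv - Ev i - Ev j ∈ PiGens :=
  Or.inl (Or.inl (Or.inr ⟨i, j, hij, hj, rfl⟩))

lemma Lv_mem_PiGens {k : ℕ} (hk : 4 ≤ k) (hk' : k ≤ 8) : Lv k ∈ PiGens :=
  Or.inl (Or.inr ⟨k, hk, hk', rfl⟩)

lemma Mv_mem_PiGens {l : ℕ} (hl : 4 ≤ l) (hl' : l ≤ 8) : Mv l ∈ PiGens :=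
  Or.inr ⟨l, hl, hl', rfl⟩

/-- A nonnegative combination of `L_k` and `M_k` splitting the weight `b` in the ratio
`1 - t : t`. -/
lemma inCone_Lv_add_Mv {k : ℕ} (hk : 4 ≤ k) (hk' : k ≤ 8) {b t : ℝ} (hb : 0 ≤ b)
    (ht : 0 ≤ t) (ht' : t ≤ 1) :
    inCone PiGens (((1 - t) * b) • Lv k + (t * b) • Mv k) :=
  inCone_add (inCone_smul (Lv_mem_PiGens hk hk') (mul_nonneg (sub_nonneg.2 ht') hb))
    (inCone_smul (Mv_mem_PiGens hk hk') (mul_nonneg ht hb))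

/-- The fraction `t` of each `L_k` moved to `M_k` so that the total degree is at most `d`. -/
lemma exists_splitting {b₁ b₃ B d : ℝ} (h₁ : 0 ≤ b₁)
    (hd : b₁ + b₃ + B ≤ d) (hd' : b₁ + 3 * b₃ + 4 * B ≤ 2 * d) :
    ∃ t : ℝ, 0 ≤ t ∧ t ≤ 1 ∧ t * (b₃ + 2 * B) ≤ b₁ ∧
      b₁ - t * (b₃ + 2 * B) + (3 + t) / 2 * b₃ + (2 + t) * B ≤ d := by
  by_cases h : b₁ < b₃ + 2 * B
  · have hpos : 0 < b₃ + 2 * B := h₁.trans_lt h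
    have hmul : b₁ / (b₃ + 2 * B) * (b₃ + 2 * B) = b₁ := div_mul_cancel₀ _ hpos.ne'
    exact ⟨b₁ / (b₃ + 2 * B), by positivity, (div_le_one hpos).2 h.le, hmul.le, by linarith⟩
  · exact ⟨1, zero_le_one, le_rfl, by linarith, by linarith⟩

lemma form_cls_alpha_zero (d : ℝ) (m : Fin 8 → ℝ) :
    form (cls d m) (α 0) = 2 * d - m 0 - m 1 - m 2 - m 3 := by
  simp +decide [form, cls, α, Hv, Ev, Fin.sum_univ_eight]
  ring

lemma form_cls_alpha_succ (d : ℝ) (m : Fin 8 → ℝ) (i : Fin 7) :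
    form (cls d m) (α i.succ) = m i.castSucc - m i.succ := by
  fin_cases i <;>
    simp +decide [form, cls, α, Hv, Ev, Fin.sum_univ_eight] <;> ring

/-- **Step 1 of Theorem `thm:wPiconvex`:** `C̄ ∩ B ⊆ Π`.  Every real class
`x = (d; m_1, …, m_8)` with `(x, α_i) ≥ 0` for all `i = 0, …, 7` and
`0 ≤ m_i ≤ d` for all `i` lies in the cone `Π`. -/
theorem chamber_inter_B_subset_Pi (d : ℝ) (m : Fin 8 → ℝ)
    (hC : ∀ i : Fin 8, 0 ≤ form (cls d m) (α i))
    (hB : ∀ i, 0 ≤ m i ∧ m i ≤ d) :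
    inCone PiGens (cls d m) := by
  have h₀ := form_cls_alpha_zero d m ▸ hC 0
  have hm (i : Fin 7) : 0 ≤ m i.castSucc - m i.succ := form_cls_alpha_succ d m i ▸ hC i.succ
  have h₁ : 0 ≤ m 0 - m 1 := hm 0
  have h₂ : 0 ≤ m 1 - m 2 := hm 1
  have h₃ : 0 ≤ m 2 - m 3 := hm 2
  have h₄ : 0 ≤ m 3 - m 4 := hm 3
  have h₅ : 0 ≤ m 4 - m 5 := hm 4
  have h₆ : 0 ≤ m 5 - m 6 := hm 5
  have h₇ : 0 ≤ m 6 - m 7 := hm 6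
  have h₈ : 0 ≤ m 7 := (hB 7).1
  obtain ⟨t, ht, ht', hr, hd⟩ := exists_splitting (b₃ := m 2 - m 3) (B := m 3)
    (d := d - (m 1 - m 2)) h₁
    (by linarith [(hB 0).2]) (by linarith)
  have htb : 0 ≤ t * (m 2 - m 3) := mul_nonneg ht h₃
  have htb' : 0 ≤ (1 - t) * (m 2 - m 3) := mul_nonneg (sub_nonneg.2 ht') h₃
  have key := inCone_add (inCone_smul Hv_mem_PiGens (sub_nonneg.2 hd)) <|
    inCone_add (inCone_smul (Hv_sub_mem_PiGens (i := 0) (by decide)) (sub_nonneg.2 hr)) <|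
    inCone_add (inCone_smul (Hv_sub_sub_mem_PiGens (i := 0) (j := 1) (by decide) (by decide))
      (c := (m 1 - m 2) + (1 + t) / 2 * (m 2 - m 3)) (by linarith)) <|
    inCone_add (inCone_smul (Hv_sub_sub_mem_PiGens (i := 0) (j := 2) (by decide) (by decide))
      (c := (1 + t) / 2 * (m 2 - m 3)) (by linarith)) <|
    inCone_add (inCone_smul (Hv_sub_sub_mem_PiGens (i := 1) (j := 2) (by decide) (by decide))
      (c := (1 - t) / 2 * (m 2 - m 3)) (by linarith)) <|
    inCone_add (inCone_Lv_add_Mv (k := 4) (by decide) (by decide) h₄ ht ht') <|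
    inCone_add (inCone_Lv_add_Mv (k := 5) (by decide) (by decide) h₅ ht ht') <|
    inCone_add (inCone_Lv_add_Mv (k := 6) (by decide) (by decide) h₆ ht ht') <|
    inCone_add (inCone_Lv_add_Mv (k := 7) (by decide) (by decide) h₇ ht ht') <|
    inCone_Lv_add_Mv (k := 8) (by decide) (by decide) h₈ ht ht'
  convert key using 1
  ext j
  fin_cases j <;>
    simp +decide [cls, Lv, Mv, Hv, Ev, Fin.sum_univ_eight, Finset.sum_filter] <;> ring
end
end

section
/- One has W·Π ⊆ 𝓑; equivalently, for every w ∈ W and every x ∈ Π, the vector w(x), written as (d; m_1, …, m_8), satisfies 0 ≤ m_i ≤ d for all i ∈ {1, …, 8}. -/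
noncomputable section

lemma form_comm (x y : V) : form x y = form y x := by
  simp only [form, mul_comm, mul_left_comm]

lemma form_add_left (a b x : V) : form (a + b) x = form a x + form b x := by
  rw [form_comm, form_add_right, form_comm x a, form_comm x b]

lemma form_smul_left (c : ℝ) (a x : V) : form (c • a) x = c * form a x := by
  rw [form_comm, form_smul_right, form_comm]

lemma reflLin_apply (a x : V) : reflLin a x = x + form a x • a := rfl

lemma sEquiv_apply (i : Fin 8) (x : V) : sEquiv i x = x + form (α i) x • α i := rfl

lemma form_reflLin_comm (a x y : V) : form x (reflLin a y) = form (reflLin a x) y := by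
  simp only [reflLin_apply, form_add_right, form_smul_right, form_add_left, form_smul_left,
    form_comm x a]
  ring

/-- The reflection in `s_a β` is conjugate, by the reflection `s_a`, to the reflection in `β`. -/
lemma reflLin_reflLin (a b x : V) (ha : form a a = -2) :
    reflLin b (reflLin a x) = reflLin a (reflLin (reflLin a b) x) := by
  rw [reflLin_apply (reflLin a b), map_add, map_smul, refl_refl a ha, ← form_reflLin_comm]
  rfl

/-- The combination `∑ c_i α_i` of the simple roots. -/
def rootComb (c : Fin 8 → ℤ) : V := ∑ i, (c i : ℝ) • α i

lemma form_alpha_alpha_nonneg {i j : Fin 8} (h : i ≠ j) : 0 ≤ form (α i) (α j) := by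
  fin_cases i <;> fin_cases j <;> first
    | exact absurd rfl h
    | simp +decide [form, α, Hv, Ev, Fin.sum_univ_eight]

lemma form_sum_right {n : ℕ} (a : V) (c : Fin n → ℝ) (g : Fin n → V) :
    form a (∑ i, c i • g i) = ∑ i, c i * form a (g i) := by
  let f : V →ₗ[ℝ] ℝ := ⟨⟨form a, form_add_right a⟩, form_smul_right a⟩
  change f _ = ∑ i, c i * f (g i)
  simp

lemma form_rootComb_nonneg {c : Fin 8 → ℤ} (hc : ∀ i, 0 ≤ c i) {y : V} (hy : y ∈ Cbar) :
    0 ≤ form (rootComb c) y := by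
  rw [form_comm, rootComb, form_sum_right]
  exact Finset.sum_nonneg fun i _ => mul_nonneg (by exact_mod_cast hc i) (hy i)

lemma rootComb_update (c : Fin 8 → ℤ) (j : Fin 8) (k : ℤ) :
    rootComb (Function.update c j (c j + k)) = rootComb c + (k : ℝ) • α j := by
  have : ∀ i, ((Function.update c j (c j + k) i : ℤ) : ℝ) • α i
      = (c i : ℝ) • α i + if i = j then (k : ℝ) • α j else 0 := by
    intro i
    by_cases h : i = j
    · subst h; simp [add_smul]
    · simp [h]
  simp only [rootComb, this, Finset.sum_add_distrib]
  simp

lemma rootComb_coords (c : Fin 8 → ℤ) :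
    rootComb c 0 = c 0 ∧ rootComb c 1 = c 1 - c 0 ∧ rootComb c 2 = c 2 - c 1 - c 0 ∧
    rootComb c 3 = c 3 - c 2 - c 0 ∧ rootComb c 4 = c 4 - c 3 - c 0 ∧
    rootComb c 5 = c 5 - c 4 ∧ rootComb c 6 = c 6 - c 5 ∧ rootComb c 7 = c 7 - c 6 ∧
    rootComb c 8 = -c 7 := by
  refine ⟨?_, ?_, ?_, ?_, ?_, ?_, ?_, ?_, ?_⟩ <;>
    simp +decide [rootComb, Fin.sum_univ_eight, α, Hv, Ev] <;> ring

lemma form_rootComb_self (c : Fin 8 → ℤ) :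
    form (rootComb c) (rootComb c) =
      -∑ i : Fin 8, (rootComb c i.succ + rootComb c 0 / 2) ^ 2 := by
  obtain ⟨h0, h1, h2, h3, h4, h5, h6, h7, h8⟩ := rootComb_coords c
  simp only [form, Fin.sum_univ_eight]
  simp only [Fin.isValue, Fin.reduceSucc, h0, h1, h2, h3, h4, h5, h6, h7, h8, Fin.succ_zero_eq_one]
  ring

lemma form_rootComb_self_nonpos (c : Fin 8 → ℤ) : form (rootComb c) (rootComb c) ≤ 0 := by
  rw [form_rootComb_self]
  exact neg_nonpos.2 (Finset.sum_nonneg fun i _ => sq_nonneg _)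

/-- An isotropic vector of the root lattice is a multiple of `2H - ∑ E_i`, so it vanishes as soon
as one of its coefficients does. -/
lemma rootComb_eq_zero {c : Fin 8 → ℤ} (h : form (rootComb c) (rootComb c) = 0) {j : Fin 8}
    (hj : c j = 0) : rootComb c = 0 := by
  rw [form_rootComb_self, neg_eq_zero, Finset.sum_eq_zero_iff_of_nonneg fun i _ => sq_nonneg _] at h
  have hz : ∀ i : Fin 8, rootComb c i.succ + rootComb c 0 / 2 = 0 := fun i =>
    pow_eq_zero_iff two_ne_zero |>.1 (h i (Finset.mem_univ i))
  obtain ⟨h0, h1, h2, h3, h4, h5, h6, h7, h8⟩ := rootComb_coords c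
  have e0 := hz 0
  have e1 := hz 1
  have e2 := hz 2
  have e3 := hz 3
  have e4 := hz 4
  have e5 := hz 5
  have e6 := hz 6
  have e7 := hz 7
  simp only [Fin.isValue, Fin.reduceSucc, h0, h1, h2, h3, h4, h5, h6, h7, h8,
    Fin.succ_zero_eq_one] at e0 e1 e2 e3 e4 e5 e6 e7
  have hj' : (c j : ℝ) = 0 := by exact_mod_cast hj
  have hd : rootComb c 0 = 0 := by
    rw [h0]
    fin_cases j <;> simp only [Fin.zero_eta, Fin.mk_one, Fin.reduceFinMk] at hj' <;> linarith
  funext i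
  refine Fin.cases hd (fun i => ?_) i
  simpa [hd] using hz i

/-- Nonnegative vectors of square `-2` in the root lattice, i.e. the positive real roots. -/
def IsPosRoot (b : V) : Prop :=
  form b b = -2 ∧ ∃ c : Fin 8 → ℤ, (∀ i, 0 ≤ c i) ∧ b = rootComb c

lemma isPosRoot_alpha (i : Fin 8) : IsPosRoot (α i) := by
  refine ⟨form_alpha_self i, Pi.single i 1, fun j => ?_, ?_⟩
  · by_cases h : j = i
    · subst h; simp
    · simp [h]
  · simp [rootComb, Pi.single_apply, ite_smul]

lemma exists_int_form_alpha (j : Fin 8) (c : Fin 8 → ℤ) :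
    ∃ k : ℤ, form (α j) (rootComb c) = k := by
  have hij : ∀ i, ∃ k : ℤ, form (α j) (α i) = k := by
    intro i
    have hint : ∀ i l, ∃ k : ℤ, α i l = k := by
      intro i l
      refine ⟨if i = 0 then (if l = 0 then 1 else if l ≤ 4 then -1 else 0)
        else if l = i.castSucc then 1 else if l = i.succ then -1 else 0, ?_⟩
      fin_cases i <;> fin_cases l <;> simp +decide [α, Hv, Ev]
    choose a ha using hint
    refine ⟨2 * a j 0 * a i 0 - ∑ l : Fin 8, a j l.succ * a i l.succ, ?_⟩
    simp [form, ha]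
  choose k hk using hij
  refine ⟨∑ i, c i * k i, ?_⟩
  rw [rootComb, form_sum_right]
  simp [hk]

/-- A simple reflection permutes the positive roots other than its own simple root. -/
lemma IsPosRoot.reflLin_alpha {b : V} (hb : IsPosRoot b) {j : Fin 8} (hne : b ≠ α j) :
    IsPosRoot (reflLin (α j) b) := by
  obtain ⟨hbb, c, hc, rfl⟩ := hb
  have hss : form (reflLin (α j) (rootComb c)) (reflLin (α j) (rootComb c)) = -2 := by
    rw [form_reflLin_comm, refl_refl _ (form_alpha_self j), hbb]
  obtain ⟨k, hk⟩ := exists_int_form_alpha j c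
  have hs : reflLin (α j) (rootComb c) = rootComb (Function.update c j (c j + k)) := by
    rw [reflLin_apply, hk, rootComb_update]
  refine ⟨hss, _, fun i => ?_, hs⟩
  by_cases hi : i = j
  swap
  · simpa [hi] using hc i
  subst hi
  rw [Function.update_self]
  by_contra! hneg
  set c' := Function.update c i 0 with hc'
  have hc'i : c' i = 0 := by simp [hc']
  set n : ℤ := c i + k
  have hq : rootComb (Function.update c i n) = rootComb c' + (n : ℝ) • α i := by
    rw [← rootComb_update, hc'i, zero_add, hc', Function.update_idem]
  have hcross : 0 ≤ form (α i) (rootComb c') := by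
    rw [rootComb, form_sum_right]
    refine Finset.sum_nonneg fun l _ => ?_
    by_cases hl : l = i
    · subst hl; simp [hc'i]
    · exact mul_nonneg (by simpa [hc', hl] using hc l) (form_alpha_alpha_nonneg (Ne.symm hl))
  have hnonpos := form_rootComb_self_nonpos c'
  have hexp : form (rootComb c') (rootComb c') + 2 * n * form (α i) (rootComb c') - 2 * n ^ 2
      = -2 := by
    rw [← hss, hs, hq]
    simp only [form_add_left, form_add_right, form_smul_left, form_smul_right, form_alpha_self,
      form_comm (rootComb c') (α i)]
    ring
  have hn : (n : ℝ) ≤ -1 := by exact_mod_cast Int.le_sub_one_of_lt hneg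
  have hn1 : (n : ℝ) = -1 := by nlinarith
  have h0 : form (rootComb c') (rootComb c') = 0 := by
    rw [hn1] at hexp; linarith
  have hz := rootComb_eq_zero h0 hc'i
  apply hne
  rw [← refl_refl _ (form_alpha_self i) (rootComb c), hs, hq, hz, hn1, reflLin_apply]
  simp only [form_smul_right, form_alpha_self, zero_add]
  module

/-- The action of a word in the simple reflections. -/
def wordAct (l : List (Fin 8)) (y : V) : V := l.foldr (fun i v => reflLin (α i) v) y

/-- A form of the exchange condition: if a positive root pairs negatively with the translate of a
dominant vector by a word, then applying its reflection can be realised by a shorter word. -/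
lemma exchange {y : V} (hy : y ∈ Cbar) (l : List (Fin 8)) :
    ∀ b, IsPosRoot b → 0 ≤ form b (wordAct l y) ∨
      ∃ l' : List (Fin 8), l'.length < l.length ∧ reflLin b (wordAct l y) = wordAct l' y := by
  induction l with
  | nil =>
    rintro b ⟨-, c, hc, rfl⟩
    exact Or.inl (form_rootComb_nonneg hc hy)
  | cons j l ih =>
    intro b hb
    change 0 ≤ form b (reflLin (α j) (wordAct l y)) ∨
      ∃ l' : List (Fin 8), _ ∧ reflLin b (reflLin (α j) (wordAct l y)) = _
    by_cases hbj : b = α j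
    · subst hbj
      exact Or.inr ⟨l, by simp, refl_refl _ (form_alpha_self j) _⟩
    · rcases ih _ (hb.reflLin_alpha hbj) with h | ⟨l', hl', h⟩
      · left
        rwa [form_reflLin_comm]
      · refine Or.inr ⟨j :: l', by simpa using hl', ?_⟩
        rw [reflLin_reflLin _ _ _ (form_alpha_self j), h]
        rfl

lemma form_le_form_wordAct {x y : V} (hx : x ∈ Cbar) (hy : y ∈ Cbar) (l : List (Fin 8)) :
    form x y ≤ form x (wordAct l y) := by
  induction hn : l.length using Nat.strong_induction_on generalizing l with
  | _ n ih =>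
    cases l with
    | nil => exact le_rfl
    | cons i l =>
      subst hn
      rcases exchange hy l (α i) (isPosRoot_alpha i) with h | ⟨l', hl', h⟩
      · have := ih l.length (by simp) l rfl
        change _ ≤ form x (reflLin (α i) (wordAct l y))
        rw [reflLin_apply, form_add_right, form_smul_right]
        nlinarith [mul_nonneg h (hx i)]
      · change _ ≤ form x (reflLin (α i) (wordAct l y))
        rw [h]
        exact ih _ (by simp; omega) l' rfl

lemma sEquiv_mem_W (i : Fin 8) : sEquiv i ∈ W := Subgroup.subset_closure ⟨i, rfl⟩

lemma exists_wordAct {w : V ≃ₗ[ℝ] V} (hw : w ∈ W) : ∃ l, ∀ y, w y = wordAct l y := by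
  induction hw using Subgroup.closure_induction_left with
  | one => exact ⟨[], fun _ => rfl⟩
  | mul_left s hs w _ ih =>
    obtain ⟨i, rfl⟩ := hs
    obtain ⟨l, hl⟩ := ih
    refine ⟨i :: l, fun y => ?_⟩
    change sEquiv i (w y) = _
    rw [hl]; rfl
  | inv_mul_cancel s hs w _ ih =>
    obtain ⟨i, rfl⟩ := hs
    obtain ⟨l, hl⟩ := ih
    refine ⟨i :: l, fun y => ?_⟩
    change (sEquiv i).symm (w y) = _
    rw [hl]; rfl

/-- On dominant vectors, pairing with a dominant vector is minimised over the `W`-orbit at the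
dominant representative. -/
lemma form_le_form_of_mem_W {x y : V} (hx : x ∈ Cbar) (hy : y ∈ Cbar) {w : V ≃ₗ[ℝ] V}
    (hw : w ∈ W) : form x y ≤ form x (w y) := by
  obtain ⟨l, hl⟩ := exists_wordAct hw
  exact hl y ▸ form_le_form_wordAct hx hy l

/-- Membership in the `W`-invariant set `𝓑`. -/
def InAllB (x : V) : Prop := ∀ w ∈ W, w x ∈ Bset

/-- Vectors pairing nonnegatively with the whole orbit of `y` are permuted by the `s_j`. -/
lemma nonneg_orbit_sEquiv {a y : V} (h : ∀ w ∈ W, 0 ≤ form a (w y)) (j : Fin 8) :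
    ∀ w ∈ W, 0 ≤ form (reflLin (α j) a) (w y) := by
  intro w hw
  rw [← form_reflLin_comm]
  exact h (sEquiv j * w) (W.mul_mem (sEquiv_mem_W j) hw)

lemma mem_Cbar_iff {x : V} : x ∈ Cbar ↔
    0 ≤ 2 * x 0 + x 1 + x 2 + x 3 + x 4 ∧ x 1 ≤ x 2 ∧ x 2 ≤ x 3 ∧ x 3 ≤ x 4 ∧ x 4 ≤ x 5 ∧
      x 5 ≤ x 6 ∧ x 6 ≤ x 7 ∧ x 7 ≤ x 8 := by
  simp only [Cbar, Set.mem_ofPred_eq, Fin.forall_fin_succ, IsEmpty.forall_iff, and_true]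
  simp +decide [form, α, Hv, Ev, Fin.sum_univ_eight]
  intros
  constructor <;> intro h <;> linarith

lemma form_Ev (i : Fin 8) (x : V) : form (Ev i) x = -x i.succ := by
  simp [form, Ev, Fin.succ_inj, ite_mul, (Fin.succ_ne_zero i).symm]

lemma form_Hv (x : V) : form Hv x = 2 * x 0 := by
  simp [form, Hv, Fin.succ_ne_zero]

lemma form_Hv_sub (i : Fin 8) (x : V) :
    form (Hv + (-2 : ℝ) • Ev i) x = 2 * (x 0 + x i.succ) := by
  rw [form_add_left, form_smul_left, form_Ev, form_Hv]; ring

lemma reflLin_alpha_Ev_succ (i : Fin 7) :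
    reflLin (α i.succ) (Ev i.succ) = Ev i.castSucc ∧
      reflLin (α i.succ) (Ev i.castSucc) = Ev i.succ ∧ reflLin (α i.succ) Hv = Hv := by
  have hα : α i.succ = Ev i.castSucc + (-1 : ℝ) • Ev i.succ := by
    rw [neg_one_smul, ← sub_eq_add_neg]
    fin_cases i <;> rfl
  simp only [reflLin_apply, form_comm (α _), form_Ev, form_Hv]
  have h1 : α i.succ i.succ.succ = -1 := by
    fin_cases i <;> simp +decide [α, Ev]
  have h2 : α i.succ i.castSucc.succ = 1 := by
    fin_cases i <;> simp +decide [α, Ev]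
  have h3 : α i.succ 0 = 0 := by
    fin_cases i <;> simp +decide [α, Ev]
  rw [h1, h2, h3, hα]
  refine ⟨?_, ?_, ?_⟩ <;> module

/-- Dominant vectors with `0 ≤ m_8` and `m_1 ≤ d` lie in `𝓑`. -/
lemma inAllB_of_mem_Cbar {y : V} (hy : y ∈ Cbar) (h8 : y 8 ≤ 0) (h1 : 0 ≤ y 0 + y 1) :
    InAllB y := by
  have hE : ∀ i : Fin 8, ∀ w ∈ W, 0 ≤ form (Ev i) (w y) := by
    intro i
    induction i using Fin.reverseInduction with
    | last =>
      intro w hw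
      refine le_trans ?_ (form_le_form_of_mem_W ?_ hy hw)
      · rw [form_Ev]; simpa using h8
      · rw [mem_Cbar_iff]; simp +decide [Ev]
    | cast i ih =>
      rw [← (reflLin_alpha_Ev_succ i).1]
      exact nonneg_orbit_sEquiv ih _
  have hF : ∀ i : Fin 8, ∀ w ∈ W, 0 ≤ form (Hv + (-2 : ℝ) • Ev i) (w y) := by
    intro i
    induction i using Fin.induction with
    | zero =>
      intro w hw
      refine le_trans ?_ (form_le_form_of_mem_W ?_ hy hw)
      · rw [form_Hv_sub]; simpa using h1
      · rw [mem_Cbar_iff]; simp +decide [Ev, Hv]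
    | succ i ih =>
      have := nonneg_orbit_sEquiv ih i.succ
      rwa [map_add, map_smul, (reflLin_alpha_Ev_succ i).2.1, (reflLin_alpha_Ev_succ i).2.2] at this
  intro w hw i
  have h1 := hE i w hw
  have h2 := hF i w hw
  rw [form_Ev] at h1
  rw [form_Hv_sub] at h2
  exact ⟨h1, by linarith⟩

lemma InAllB.map {x : V} (hx : InAllB x) {w : V ≃ₗ[ℝ] V} (hw : w ∈ W) : InAllB (w x) :=
  fun u hu => hx (u * w) (W.mul_mem hu hw)

lemma InAllB.of_inCone {S : Set V} (hS : ∀ g ∈ S, InAllB g) {x : V} (hx : inCone S x) :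
    InAllB x := by
  obtain ⟨n, c, g, hc, hg, rfl⟩ := hx
  intro w hw i
  have h : ∀ k, 0 ≤ -w (g k) i.succ ∧ -w (g k) i.succ ≤ w (g k) 0 :=
    fun k => hS _ (hg k) w hw i
  simp only [map_sum, map_smul, Finset.sum_apply, Pi.smul_apply, smul_eq_mul]
  rw [← Finset.sum_neg_distrib]
  refine ⟨Finset.sum_nonneg fun k _ => ?_, Finset.sum_le_sum fun k _ => ?_⟩
  · nlinarith [mul_nonneg (hc k) (h k).1]
  · nlinarith [mul_le_mul_of_nonneg_left (h k).2 (hc k)]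

lemma inAllB_of_mem_PiGens {g : V} (hg : g ∈ PiGens) : InAllB g := by
  have hsucc : ∀ i : Fin 7, sEquiv i.succ (Ev i.castSucc) = Ev i.succ :=
    fun i => (reflLin_alpha_Ev_succ i).2.1
  have hHv : ∀ i : Fin 7, sEquiv i.succ Hv = Hv := fun i => (reflLin_alpha_Ev_succ i).2.2
  rcases hg with (((hg | ⟨i, hi, rfl⟩) | ⟨i, j, hij, hj, rfl⟩) | ⟨k, hk, hk', rfl⟩) |
    ⟨l, hl, hl', rfl⟩
  · obtain rfl : g = Hv := hg
    apply inAllB_of_mem_Cbar <;> simp +decide [mem_Cbar_iff, Hv]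
  · have h0 : InAllB (Hv - Ev 0) := by
      apply inAllB_of_mem_Cbar <;> norm_num +decide [mem_Cbar_iff, Hv, Ev]
    have h1 : InAllB (Hv - Ev 1) := by
      have := h0.map (sEquiv_mem_W 1)
      rwa [map_sub, show sEquiv 1 Hv = Hv from hHv 0, show sEquiv 1 (Ev 0) = Ev 1 from hsucc 0]
        at this
    have h2 : InAllB (Hv - Ev 2) := by
      have := h1.map (sEquiv_mem_W 2)
      rwa [map_sub, show sEquiv 2 Hv = Hv from hHv 1, show sEquiv 2 (Ev 1) = Ev 2 from hsucc 1]
        at this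
    obtain rfl | rfl | rfl : i = 0 ∨ i = 1 ∨ i = 2 := by omega
    exacts [h0, h1, h2]
  · have e20 : sEquiv 2 (Ev 0) = Ev 0 := by
      rw [sEquiv_apply, form_comm, form_Ev]; simp +decide [α, Ev]
    have e12 : sEquiv 1 (Ev 2) = Ev 2 := by
      rw [sEquiv_apply, form_comm, form_Ev]; simp +decide [α, Ev]
    have h01 : InAllB (Hv - Ev 0 - Ev 1) := by
      apply inAllB_of_mem_Cbar <;> norm_num +decide [mem_Cbar_iff, Hv, Ev]
    have h02 : InAllB (Hv - Ev 0 - Ev 2) := by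
      have := h01.map (sEquiv_mem_W 2)
      rwa [map_sub, map_sub, show sEquiv 2 Hv = Hv from hHv 1,
        show sEquiv 2 (Ev 1) = Ev 2 from hsucc 1, e20] at this
    have h12 : InAllB (Hv - Ev 1 - Ev 2) := by
      have := h02.map (sEquiv_mem_W 1)
      rwa [map_sub, map_sub, show sEquiv 1 Hv = Hv from hHv 0,
        show sEquiv 1 (Ev 0) = Ev 1 from hsucc 0, e12] at this
    obtain ⟨rfl, rfl⟩ | ⟨rfl, rfl⟩ | ⟨rfl, rfl⟩ :
        i = 0 ∧ j = 1 ∨ i = 0 ∧ j = 2 ∨ i = 1 ∧ j = 2 := by omega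
    exacts [h01, h02, h12]
  · interval_cases k <;> apply inAllB_of_mem_Cbar <;>
      norm_num +decide [mem_Cbar_iff, Hv, Ev, Finset.sum_filter, Fin.sum_univ_eight]
  · interval_cases l <;> apply inAllB_of_mem_Cbar <;>
      norm_num +decide [mem_Cbar_iff, Hv, Ev, Finset.sum_filter, Fin.sum_univ_eight]

/-- **Lemma `lem:wPiinB`:** `W·Π ⊆ 𝓑 = ⋂_{w∈W} w⁻¹(B)`; equivalently, for every
`w ∈ W` and `x ∈ Π` the class `w(x) = (d; m_1, …, m_8)` satisfies `0 ≤ m_i ≤ d`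
for all `i`. -/
theorem WPi_subset_B :
    (⋃ w ∈ W, (w : V ≃ₗ[ℝ] V) '' PiCone) ⊆ ⋂ w ∈ W, (w : V ≃ₗ[ℝ] V) ⁻¹' Bset := by
  rintro _ hz
  simp only [Set.mem_iUnion] at hz
  obtain ⟨w, hw, x, hx, rfl⟩ := hz
  simp only [Set.mem_iInter]
  intro u hu
  exact (InAllB.of_inCone (fun g => inAllB_of_mem_PiGens) hx).map hw u hu
end
end
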